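/- Let N be a topological space, E a real normed vector space, X : E → ℝ a continuous linear functional, and μ : N → E a continuous map. Suppose there is a compact set P ⊆ {e ∈ E : X(e) = 1} with μ(N) ⊆ { s · p : s > 0, p ∈ P }, and suppose the function f = X ∘ μ is proper as a map into (0,∞), i.e. for all real numbers 0 < a ≤ b the set {x ∈ N : a ≤ f(x) ≤ b} is compact. Then μ is proper as a map into E ∖ {0}: for every compact set K ⊆ E with 0 ∉ K, the preimage μ⁻¹(K) is compact. -/

import Mathlib

/-- Let `N` be a topological space, `E` a real normed vector space,
`X : E →L[ℝ] ℝ` a continuous linear functional and `μ : N → E` continuous.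
Suppose there is a compact set `P ⊆ {e | X e = 1}` with
`μ(N) ⊆ {s • p | s > 0, p ∈ P}`, and that `f = X ∘ μ` is proper as a map into
`(0, ∞)`.  Then `μ` is proper as a map into `E ∖ {0}`. -/
theorem stmt4 {N : Type*} [TopologicalSpace N]
    {E : Type*} [NormedAddCommGroup E] [NormedSpace ℝ E]
    (X : E →L[ℝ] ℝ) (μ : N → E) (hμ : Continuous μ)
    (P : Set E) (hP_compact : IsCompact P) (hP_sub : P ⊆ {e : E | X e = 1})
    (hμ_range : Set.range μ ⊆ {w : E | ∃ s : ℝ, 0 < s ∧ ∃ p ∈ P, w = s • p})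
    (f : N → ℝ) (hf : f = fun x => X (μ x))
    (hf_proper : ∀ a b : ℝ, 0 < a → a ≤ b →
      IsCompact {x : N | a ≤ f x ∧ f x ≤ b}) :
    ∀ K : Set E, IsCompact K → (0 : E) ∉ K → IsCompact (μ ⁻¹' K) := by
  intro K hK h0
  obtain ⟨δ, hδ, hball⟩ := Metric.isOpen_iff.mp hK.isClosed.isOpen_compl 0 h0
  obtain ⟨C, hC, hPC⟩ := hP_compact.isBounded.exists_pos_norm_le
  obtain ⟨B, hB⟩ := (hK.image X.continuous).bddAbove
  refine (hf_proper (δ / C) (max (δ / C) B) (div_pos hδ hC)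
    (le_max_left _ _)).of_isClosed_subset (hK.isClosed.preimage hμ) fun x hx => ?_
  obtain ⟨s, hs, p, hp, hsp⟩ := hμ_range ⟨x, rfl⟩
  have hfx : f x = s := by
    have hXp : X p = 1 := hP_sub hp
    simp [hf, hsp, hXp]
  have hδ_le : δ ≤ ‖μ x‖ := by
    by_contra! h
    exact hball (mem_ball_zero_iff.mpr h) hx
  constructor
  · rw [hfx, div_le_iff₀ hC]
    calc δ ≤ ‖μ x‖ := hδ_le
      _ = s * ‖p‖ := by rw [hsp, norm_smul, Real.norm_of_nonneg hs.le]
      _ ≤ s * C := mul_le_mul_of_nonneg_left (hPC p hp) hs.le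
  · rw [hf]
    exact le_max_of_le_right (hB ⟨μ x, hx, rfl⟩)
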